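/- arXiv:1406.5577 — 9 statements merged into one kernel-verified Lean document; each statement's English description precedes it below -/
import Mathlib

section
/- Let L be a real positive semidefinite N×N matrix. Then for every subset A of {1,…,N}, the sum over all subsets S with A ⊆ S of det(L_S) equals det(L + I) · det(K_A), where K = L(L+I)⁻¹. In particular, the L-ensemble μ(S) = det(L_S)/det(L+I) is a determinantal point process with kernel K = L(L+I)⁻¹ = I − (L+I)⁻¹. -/
open Matrix BigOperators

/-- The submatrix of `K` with rows indexed by `A` and columns indexed by `B`. -/
def subm {N : ℕ} (K : Matrix (Fin N) (Fin N) ℝ) (A B : Finset (Fin N)) :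
    Matrix A B ℝ := fun i j => K i.1 j.1

open scoped Classical in
/-- The probability of the event `E` under the measure `μ`. -/
noncomputable def pr {N : ℕ} (μ : Finset (Fin N) → ℝ) (E : Finset (Fin N) → Prop) : ℝ :=
  ∑ S : Finset (Fin N), if E S then μ S else 0

/-- `μ` is a determinantal point process with kernel `K`. -/
noncomputable def IsDPP {N : ℕ} (μ : Finset (Fin N) → ℝ)
    (K : Matrix (Fin N) (Fin N) ℝ) : Prop :=
  (∀ S, 0 ≤ μ S) ∧ (∑ S : Finset (Fin N), μ S = 1) ∧
  ∀ A : Finset (Fin N), pr μ (fun S => A ⊆ S) = (subm K A A).det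

/-- Expanding along the rows outside `A`: the principal minors of `M` on the supersets of `A` sum
to the determinant of `M + 1` with the rows in `A` replaced by those of `M`. -/
theorem sum_superset_det_submatrix {n R : Type*} [Fintype n] [DecidableEq n] [CommRing R]
    (M : Matrix n n R) (A : Finset n) :
    ∑ S ∈ Finset.univ.filter (fun S => A ⊆ S), (M.submatrix (↑) (↑) : Matrix S S R).det
      = (Matrix.of (A.piecewise M.row (M + 1).row)).det := by
  have hadd : (Matrix.of (A.piecewise M.row (M + 1).row) : n → n → R)
      = M.row + A.piecewise (0 : Matrix n n R).row (1 : Matrix n n R).row := by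
    funext i j
    by_cases hi : i ∈ A <;> simp [hi]
  change _ = (detRowAlternating : (n → R) [⋀^n]→ₗ[R] R) _
  rw [hadd, AlternatingMap.map_add_univ, Finset.sum_filter]
  refine Finset.sum_congr rfl fun S _ => ?_
  split_ifs with h
  · rw [← det_piecewise_one_eq_submatrix_det]
    change _ = Matrix.det _
    congr 1
    funext i j
    by_cases hi : i ∈ S
    · simp [hi]
    · simp [hi, Finset.notMem_mono h hi]
  · obtain ⟨i, hiA, hiS⟩ := Finset.not_subset.mp h
    exact (AlternatingMap.map_coord_zero _ i (by ext j; simp [hiA, hiS])).symm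

/-- If `K * B = M`, replacing the rows of `B` in `A` by those of `M` multiplies the determinant by
the principal minor of `K` on `A`. -/
theorem det_piecewise_row_eq_mul {n R : Type*} [Fintype n] [DecidableEq n] [CommRing R]
    {K B M : Matrix n n R} (h : K * B = M) (A : Finset n) :
    (Matrix.of (A.piecewise M.row B.row)).det
      = B.det * (K.submatrix (↑) (↑) : Matrix A A R).det := by
  rw [← det_piecewise_one_eq_submatrix_det, mul_comm, ← det_mul]
  congr 1
  ext i j
  by_cases hi : i ∈ A
  · simp [← h, mul_apply, hi]
  · simp [mul_apply, hi, one_apply]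

/-- An `L`-ensemble with positive semidefinite kernel `L` is a DPP with kernel
`K = L(L+I)⁻¹ = I - (L+I)⁻¹`. -/
theorem lEnsemble_isDPP {N : ℕ} (L : Matrix (Fin N) (Fin N) ℝ) (hL : L.PosSemidef) :
    (∀ A : Finset (Fin N),
      ∑ S ∈ Finset.univ.filter (fun S => A ⊆ S), (subm L S S).det
        = (L + 1).det * (subm (L * (L + 1)⁻¹) A A).det) ∧
    L * (L + 1)⁻¹ = 1 - (L + 1)⁻¹ ∧
    IsDPP (fun S => (subm L S S).det / (L + 1).det) (L * (L + 1)⁻¹) := by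
  have hdet : 0 < (L + 1).det := (PosDef.posSemidef_add hL PosDef.one).det_pos
  have hunit : IsUnit (L + 1).det := hdet.ne'.isUnit
  have hsum : ∀ A : Finset (Fin N),
      ∑ S ∈ Finset.univ.filter (fun S => A ⊆ S), (subm L S S).det
        = (L + 1).det * (subm (L * (L + 1)⁻¹) A A).det := fun A =>
    (sum_superset_det_submatrix L A).trans
      (det_piecewise_row_eq_mul (nonsing_inv_mul_cancel_right _ L hunit) A)
  refine ⟨hsum, ?_, fun S => ?_, ?_, fun A => ?_⟩
  · rw [eq_sub_iff_add_eq]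
    nth_rw 2 [← one_mul (L + 1)⁻¹]
    rw [← add_mul, mul_nonsing_inv _ hunit]
  · exact div_nonneg (hL.submatrix ((↑) : S → Fin N)).det_nonneg hdet.le
  · rw [← Finset.sum_div, div_eq_one_iff_eq hdet.ne']
    simpa using hsum ∅
  · rw [eq_div_of_mul_eq hdet.ne' ((mul_comm _ _).trans (hsum A).symm), Finset.sum_div,
      Finset.sum_filter]
    refine Finset.sum_congr rfl fun S _ => ?_
    congr
end

section
/- Let M = [[U, V],[Vᵀ, W]] be a real symmetric block matrix with U and W square. If M is positive definite, then det M = det U · det W holds if and only if V = 0. -/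
open Matrix

namespace Matrix

open scoped MatrixOrder in
lemma PosSemidef.exists_eq_conjTranspose_mul_self {ι : Type*} [Fintype ι] [DecidableEq ι]
    {A : Matrix ι ι ℝ} (hA : A.PosSemidef) : ∃ B : Matrix ι ι ℝ, A = Bᴴ * B :=
  CStarAlgebra.nonneg_iff_eq_star_mul_self.mp hA.nonneg

lemma PosSemidef.eq_zero_of_det_one_add_eq_one {ι : Type*} [Fintype ι] [DecidableEq ι]
    {Q : Matrix ι ι ℝ} (hQ : Q.PosSemidef) (h : (1 + Q).det = 1) : Q = 0 := by
  have hdet : (1 + Q).det = ∏ i, (1 + hQ.isHermitian.eigenvalues i) := by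
    have hneg : (1 + Q).det = (-1) ^ Fintype.card ι * Q.charpoly.eval (-1) := by
      rw [eval_charpoly, ← det_neg]
      congr 1
      rw [map_neg, map_one, neg_sub, sub_neg_eq_add, add_comm]
    rw [hneg, hQ.isHermitian.charpoly_eq, Polynomial.eval_prod, ← Finset.card_univ,
      ← Finset.prod_const, ← Finset.prod_mul_distrib]
    refine Finset.prod_congr rfl fun i _ => ?_
    simp
    ring
  rw [← hQ.isHermitian.eigenvalues_eq_zero_iff]
  funext i
  have hnonneg := hQ.eigenvalues_nonneg
  have hle : 1 + hQ.isHermitian.eigenvalues i ≤ 1 := by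
    refine le_of_le_of_eq ?_ (hdet.symm.trans h)
    rw [← Finset.mul_prod_erase _ _ (Finset.mem_univ i)]
    refine le_mul_of_one_le_right (by linarith [hnonneg i]) ?_
    exact Finset.one_le_prod fun j _ => by linarith [hnonneg j]
  exact le_antisymm (by simpa using hle) (hnonneg i)

lemma PosDef.eq_zero_of_det_add_eq {ι : Type*} [Fintype ι] [DecidableEq ι]
    {S P : Matrix ι ι ℝ} (hS : S.PosDef) (hP : P.PosSemidef) (h : (S + P).det = S.det) :
    P = 0 := by
  obtain ⟨B, rfl⟩ := hS.posSemidef.exists_eq_conjTranspose_mul_self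
  have hdet := hS.det_pos.ne'
  rw [det_mul] at hdet
  have hB : IsUnit B.det := (right_ne_zero_of_mul hdet).isUnit
  have hBH : IsUnit Bᴴ.det := (left_ne_zero_of_mul hdet).isUnit
  have hPQ : P = Bᴴ * ((B⁻¹)ᴴ * P * B⁻¹) * B := by
    rw [conjTranspose_nonsing_inv, Matrix.mul_assoc, nonsing_inv_mul_cancel_right _ _ hB,
      mul_nonsing_inv_cancel_left _ _ hBH]
  have hfac : Bᴴ * B + P = Bᴴ * (1 + (B⁻¹)ᴴ * P * B⁻¹) * B := by
    rw [Matrix.mul_add, Matrix.add_mul, Matrix.mul_one, ← hPQ]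
  rw [hfac, det_mul, det_mul, det_mul, mul_right_comm] at h
  rw [hPQ, (hP.conjTranspose_mul_mul_same B⁻¹).eq_zero_of_det_one_add_eq_one
    ((mul_eq_left₀ hdet).mp h)]
  simp

lemma PosDef.eq_zero_of_conjTranspose_mul_mul_eq_zero {ι κ : Type*} [Fintype ι] [DecidableEq ι]
    [Fintype κ] {A : Matrix ι ι ℝ} (hA : A.PosDef) {V : Matrix ι κ ℝ} (h : Vᴴ * A * V = 0) :
    V = 0 := by
  obtain ⟨C, rfl⟩ := hA.posSemidef.exists_eq_conjTranspose_mul_self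
  have hC : IsUnit C.det := by
    have hdet := hA.det_pos.ne'
    rw [det_mul] at hdet
    exact (right_ne_zero_of_mul hdet).isUnit
  have hCV : C * V = 0 := by
    rw [← conjTranspose_mul_self_eq_zero, conjTranspose_mul]
    simpa only [Matrix.mul_assoc] using h
  rw [← nonsing_inv_mul_cancel_left C V hC, hCV, Matrix.mul_zero]

end Matrix

/-- For a positive definite block matrix `M = [[U, V],[Vᵀ, W]]`,
`det M = det U * det W` holds if and only if `V = 0`. -/
theorem det_fromBlocks_eq_mul_iff_of_posDef {n m : ℕ}
    (U : Matrix (Fin n) (Fin n) ℝ) (W : Matrix (Fin m) (Fin m) ℝ)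
    (V : Matrix (Fin n) (Fin m) ℝ)
    (hM : (Matrix.fromBlocks U V Vᵀ W).PosDef) :
    (Matrix.fromBlocks U V Vᵀ W).det = U.det * W.det ↔ V = 0 := by
  refine ⟨fun h => ?_, fun h => by simp [h]⟩
  rw [← conjTranspose_eq_transpose_of_trivial] at hM h
  have hU : U.PosDef := hM.submatrix (e := Sum.inl) Sum.inl_injective
  let := U.invertibleOfIsUnitDet hU.det_pos.ne'.isUnit
  have hdet := hM.det_pos
  rw [det_fromBlocks₁₁, invOf_eq_nonsing_inv] at h hdet
  have hS : (W - Vᴴ * U⁻¹ * V).PosDef :=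
    ((hU.fromBlocks₁₁ V W).mp hM.posSemidef).posDef_iff_det_ne_zero.mpr
      (right_ne_zero_of_mul hdet.ne')
  have hP := hU.inv.posSemidef.conjTranspose_mul_mul_same V
  refine hU.inv.eq_zero_of_conjTranspose_mul_mul_eq_zero (hS.eq_zero_of_det_add_eq hP ?_)
  rw [sub_add_cancel]
  exact (mul_left_cancel₀ hU.det_pos.ne' h).symm
end

section
/- Let M = [[U, V],[Vᵀ, W]] be a real symmetric block matrix with U and W square. If U is positive definite and W is negative definite, then det M = det U · det W holds if and only if V = 0. -/
open Matrix

open scoped MatrixOrder in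
theorem Matrix.PosDef.exists_isUnit_conjTranspose_mul_self {n : Type*} [Fintype n] [DecidableEq n]
    {A : Matrix n n ℝ} (hA : A.PosDef) : ∃ S : Matrix n n ℝ, IsUnit S ∧ A = Sᴴ * S := by
  obtain ⟨S, hS⟩ := CStarAlgebra.nonneg_iff_eq_star_mul_self.mp hA.posSemidef.nonneg
  refine ⟨S, ?_, hS⟩
  have h := (isUnit_iff_isUnit_det _).mp hA.isUnit
  rw [hS, det_mul] at h
  exact (isUnit_iff_isUnit_det _).mpr (isUnit_of_mul_isUnit_right h)

theorem Matrix.IsHermitian.det_one_add_eq_prod {n : Type*} [Fintype n] [DecidableEq n]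
    {C : Matrix n n ℝ} (hC : C.IsHermitian) :
    (1 + C).det = ∏ i, (1 + hC.eigenvalues i) := by
  have h := congrArg (Polynomial.eval (-1)) hC.charpoly_eq
  have h₁ : scalar n (-1 : ℝ) - C = -(1 + C) := by
    rw [map_neg, map_one, neg_add, sub_eq_add_neg]
  rw [eval_charpoly, h₁, det_neg, Polynomial.eval_prod] at h
  have h₂ (i : n) : Polynomial.eval (-1) (Polynomial.X - Polynomial.C (hC.eigenvalues i)) =
      -1 * (1 + hC.eigenvalues i) := by
    rw [Polynomial.eval_sub, Polynomial.eval_X, Polynomial.eval_C]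
    ring
  simp only [RCLike.ofReal_real_eq_id, id_eq, h₂, Finset.prod_mul_distrib, Finset.prod_const,
    Finset.card_univ] at h
  exact mul_left_cancel₀ (pow_ne_zero _ (by norm_num)) h

theorem Finset.one_add_sum_le_prod_one_add {ι : Type*} (s : Finset ι) {f : ι → ℝ}
    (hf : ∀ i, 0 ≤ f i) : 1 + ∑ i ∈ s, f i ≤ ∏ i ∈ s, (1 + f i) := by
  classical
  induction s using Finset.induction_on with
  | empty => simp
  | insert a s ha ih =>
    rw [Finset.sum_insert ha, Finset.prod_insert ha]
    have hsum : 0 ≤ ∑ i ∈ s, f i := Finset.sum_nonneg fun i _ => hf i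
    nlinarith [mul_le_mul_of_nonneg_left ih (hf a), mul_nonneg (hf a) hsum]

theorem Matrix.PosSemidef.one_add_trace_le_det_one_add {n : Type*} [Fintype n] [DecidableEq n]
    {C : Matrix n n ℝ} (hC : C.PosSemidef) : 1 + C.trace ≤ (1 + C).det := by
  rw [hC.isHermitian.det_one_add_eq_prod, hC.isHermitian.trace_eq_sum_eigenvalues]
  exact Finset.univ.one_add_sum_le_prod_one_add hC.eigenvalues_nonneg

theorem Matrix.PosSemidef.eq_zero_of_det_add_eq {n : Type*} [Fintype n] [DecidableEq n]
    {A B : Matrix n n ℝ} (hB : B.PosSemidef) (hA : A.PosDef) (h : (A + B).det = A.det) :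
    B = 0 := by
  obtain ⟨S, hS, rfl⟩ := hA.exists_isUnit_conjTranspose_mul_self
  have hdet := (isUnit_iff_isUnit_det S).mp hS
  set C := (S⁻¹)ᴴ * B * S⁻¹ with hC
  have hCpos : C.PosSemidef := hB.conjTranspose_mul_mul_same S⁻¹
  have hBC : B = Sᴴ * C * S := by
    have h₁ : Sᴴ * (S⁻¹)ᴴ = 1 := by
      rw [← conjTranspose_mul, nonsing_inv_mul _ hdet, conjTranspose_one]
    calc B = (Sᴴ * (S⁻¹)ᴴ) * B * (S⁻¹ * S) := by
          rw [h₁, nonsing_inv_mul _ hdet, Matrix.one_mul, Matrix.mul_one]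
      _ = Sᴴ * C * S := by simp only [hC, Matrix.mul_assoc]
  have hfactor : Sᴴ * S + B = Sᴴ * (1 + C) * S := by
    rw [hBC, Matrix.mul_add, Matrix.add_mul, Matrix.mul_one]
  have hone : (1 + C).det = 1 := by
    have hne := hdet.ne_zero
    rw [hfactor] at h
    simp only [det_mul, det_conjTranspose, star_trivial] at h
    exact mul_left_cancel₀ (mul_ne_zero hne hne) (by linarith)
  have htrace : C.trace = 0 :=
    le_antisymm (by linarith [hCpos.one_add_trace_le_det_one_add]) hCpos.trace_nonneg
  rw [hBC, hCpos.trace_eq_zero_iff.mp htrace, Matrix.mul_zero, Matrix.zero_mul]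

theorem Matrix.PosDef.eq_zero_of_conjTranspose_mul_mul_same_eq_zero {n m : Type*}
    [Fintype n] [DecidableEq n] {A : Matrix n n ℝ} (hA : A.PosDef)
    {V : Matrix n m ℝ} (h : Vᴴ * A * V = 0) : V = 0 := by
  obtain ⟨S, hS, rfl⟩ := hA.exists_isUnit_conjTranspose_mul_self
  have hSV : S * V = 0 := by
    rw [← conjTranspose_mul_self_eq_zero, conjTranspose_mul, ← h]
    simp only [Matrix.mul_assoc]
  rw [← nonsing_inv_mul_cancel_left S V ((isUnit_iff_isUnit_det S).mp hS), hSV, Matrix.mul_zero]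

/-- For a symmetric block matrix `M = [[U, V],[Vᵀ, W]]` with `U` positive definite and
`W` negative definite, `det M = det U * det W` holds if and only if `V = 0`. -/
theorem det_fromBlocks_eq_mul_iff_of_posDef_negDef {n m : ℕ}
    (U : Matrix (Fin n) (Fin n) ℝ) (W : Matrix (Fin m) (Fin m) ℝ)
    (V : Matrix (Fin n) (Fin m) ℝ)
    (hU : U.IsSymm) (hW : W.IsSymm) (hUpos : U.PosDef) (hWneg : (-W).PosDef) :
    (Matrix.fromBlocks U V Vᵀ W).det = U.det * W.det ↔ V = 0 := by
  refine ⟨fun h => ?_, fun h => by simp [h]⟩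
  let _ := hUpos.isUnit.invertible
  rw [det_fromBlocks₁₁, invOf_eq_nonsing_inv, ← conjTranspose_eq_transpose_of_trivial] at h
  have hschur := mul_left_cancel₀ hUpos.det_pos.ne' h
  refine hUpos.inv.eq_zero_of_conjTranspose_mul_mul_same_eq_zero
    ((hUpos.inv.posSemidef.conjTranspose_mul_mul_same V).eq_zero_of_det_add_eq hWneg ?_)
  rw [show -W + Vᴴ * U⁻¹ * V = -(W - Vᴴ * U⁻¹ * V) by abel, det_neg, det_neg, hschur]
end

section
/- Let μ be a determinantal point process over 𝒴 = Fin N with real symmetric kernel K satisfying 0 ≺ K ≺ I, and let A and B be disjoint subsets of 𝒴. Then Pr(A ⊆ Y and B ⊆ Y) = Pr(A ⊆ Y)·Pr(B ⊆ Y) (equivalently, det K_{A∪B} = det K_A · det K_B) if and only if K_{A,B} = 0. -/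
open Matrix BigOperators

/-- Adding a nonzero positive semidefinite matrix to the identity changes the determinant. -/
theorem Matrix.PosSemidef.eq_zero_of_det_one_add_eq_one_s5 {n : Type*} [Fintype n] [DecidableEq n]
    {M : Matrix n n ℝ} (hM : M.PosSemidef) (h : (1 + M).det = 1) : M = 0 := by
  have hdet : (1 + M).det = ∏ i, (1 + hM.isHermitian.eigenvalues i) := by
    have hev := congrArg (Polynomial.eval (-1)) hM.isHermitian.charpoly_eq
    rw [eval_charpoly, Polynomial.eval_prod] at hev
    have hneg : scalar n (-1 : ℝ) - M = -(1 + M) := by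
      rw [map_neg, map_one]; abel
    rw [hneg, det_neg] at hev
    have hprod : ∏ i, Polynomial.eval (-1 : ℝ)
        (Polynomial.X - Polynomial.C (hM.isHermitian.eigenvalues i : ℝ)) =
        (-1) ^ Fintype.card n * ∏ i, (1 + hM.isHermitian.eigenvalues i) := by
      rw [Fintype.card, ← Finset.prod_const, ← Finset.prod_mul_distrib]
      refine Finset.prod_congr rfl fun i _ => ?_
      simp only [Polynomial.eval_sub, Polynomial.eval_X, Polynomial.eval_C]
      ring
    exact mul_left_cancel₀ (pow_ne_zero _ (by norm_num)) (hev.trans hprod)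
  rw [← hM.isHermitian.eigenvalues_eq_zero_iff]
  funext i
  have hle : 1 + hM.isHermitian.eigenvalues i ≤ ∏ j, (1 + hM.isHermitian.eigenvalues j) := by
    rw [← Finset.mul_prod_erase _ _ (Finset.mem_univ i)]
    refine le_mul_of_one_le_right (by linarith [hM.eigenvalues_nonneg i]) ?_
    exact Finset.one_le_prod fun j _ => by linarith [hM.eigenvalues_nonneg j]
  rw [Pi.zero_apply]
  linarith [hM.eigenvalues_nonneg i]

open scoped MatrixOrder in
/-- Adding a nonzero positive semidefinite matrix to a positive definite one changes the
determinant. -/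
theorem Matrix.PosDef.eq_zero_of_det_add_eq_det {n : Type*} [Fintype n] [DecidableEq n]
    {S E : Matrix n n ℝ} (hS : S.PosDef) (hE : E.PosSemidef) (h : (S + E).det = S.det) :
    E = 0 := by
  obtain ⟨Y, hY⟩ := CStarAlgebra.nonneg_iff_eq_star_mul_self.mp hS.posSemidef.nonneg
  rw [star_eq_conjTranspose] at hY
  have hYdet : Y.det ≠ 0 := fun h0 => hS.det_pos.ne' (by rw [hY, det_mul, h0, mul_zero])
  have hYu : IsUnit Y.det := hYdet.isUnit
  have hYu' : IsUnit Yᴴ.det := by rw [det_conjTranspose]; exact hYu.star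
  set M := Y⁻¹ᴴ * E * Y⁻¹ with hMdef
  have hEM : E = Yᴴ * M * Y := by
    rw [hMdef, conjTranspose_nonsing_inv, Matrix.mul_assoc, Matrix.mul_assoc,
      nonsing_inv_mul _ hYu, Matrix.mul_one, mul_nonsing_inv_cancel_left _ _ hYu']
  have hsum : S + E = Yᴴ * (1 + M) * Y := by
    rw [Matrix.mul_add, Matrix.add_mul, Matrix.mul_one, ← hY, ← hEM]
  rw [hsum, hY, det_mul, det_mul, det_mul, mul_right_comm] at h
  have hM : M = 0 :=
    (hE.conjTranspose_mul_mul_same _).eq_zero_of_det_one_add_eq_one_s5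
      ((mul_eq_left₀ (mul_ne_zero hYu'.ne_zero hYdet)).mp h)
  rw [hEM, hM, Matrix.mul_zero, Matrix.zero_mul]

/-- Equality in **Fischer's inequality**: the determinant of a positive definite block matrix is
the product of the determinants of its diagonal blocks iff the off-diagonal block vanishes. -/
theorem Matrix.PosDef.det_fromBlocks_eq_mul_iff {m n : Type*} [Fintype m] [Fintype n]
    [DecidableEq m] [DecidableEq n] {A : Matrix m m ℝ} {B : Matrix m n ℝ} {D : Matrix n n ℝ}
    (hP : (fromBlocks A B Bᴴ D).PosDef) :
    (fromBlocks A B Bᴴ D).det = A.det * D.det ↔ B = 0 := by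
  refine ⟨fun h => ?_, fun h => by rw [h, conjTranspose_zero, det_fromBlocks_zero₂₁]⟩
  have hA : A.PosDef := hP.submatrix (e := Sum.inl) Sum.inl_injective
  let : Invertible A := hA.isUnit.invertible
  have hSchur := (PosDef.fromBlocks₁₁ B D hA).mp hP.posSemidef
  have hE := hA.inv.posSemidef.conjTranspose_mul_mul_same B
  have hdet := hP.det_pos
  rw [det_fromBlocks₁₁, invOf_eq_nonsing_inv] at h hdet
  have hSdet := mul_left_cancel₀ hA.det_pos.ne' h
  have hS : (D - Bᴴ * A⁻¹ * B).PosDef :=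
    hSchur.posDef_iff_det_ne_zero.mpr (right_ne_zero_of_mul hdet.ne')
  have hE0 := hS.eq_zero_of_det_add_eq_det hE (by rw [sub_add_cancel, hSdet])
  ext i j
  by_contra hij
  have hcol : B *ᵥ Pi.single j 1 ≠ 0 := fun h0 => hij (by simpa using congrFun h0 i)
  refine (hA.inv.dotProduct_mulVec_pos hcol).ne' ?_
  rw [star_mulVec, ← dotProduct_mulVec, mulVec_mulVec, mulVec_mulVec, hE0,
    zero_mulVec, dotProduct_zero]

/-- A positive definite kernel satisfies `det K_{A∪B} = det K_A * det K_B` for disjoint `A`, `B`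
iff `K_{A,B} = 0`. -/
theorem det_subm_union_eq_mul_iff {N : ℕ} {K : Matrix (Fin N) (Fin N) ℝ} (hK : K.PosDef)
    {A B : Finset (Fin N)} (hAB : Disjoint A B) :
    (subm K (A ∪ B) (A ∪ B)).det = (subm K A A).det * (subm K B B).det ↔ subm K A B = 0 := by
  have hblocks : (subm K (A ∪ B) (A ∪ B)).submatrix (Equiv.Finset.union A B hAB)
      (Equiv.Finset.union A B hAB) =
      fromBlocks (subm K A A) (subm K A B) (subm K A B)ᴴ (subm K B B) := by
    ext (i | i) (j | j)
    · rfl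
    · rfl
    · exact (hK.isHermitian.apply _ _).symm
    · rfl
  have hpos : (subm K (A ∪ B) (A ∪ B)).PosDef := hK.submatrix Subtype.val_injective
  have hP := hpos.submatrix (Equiv.Finset.union A B hAB).injective
  rw [← det_submatrix_equiv_self (Equiv.Finset.union A B hAB), hblocks]
  rw [hblocks] at hP
  exact hP.det_fromBlocks_eq_mul_iff

/-- For a DPP with kernel `0 ≺ K ≺ I` and disjoint `A`, `B`, the events `A ⊆ Y` and
`B ⊆ Y` are independent (equivalently `det K_{A∪B} = det K_A * det K_B`) iff `K_{A,B} = 0`. -/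
theorem dpp_subset_independent_iff {N : ℕ} (μ : Finset (Fin N) → ℝ)
    (K : Matrix (Fin N) (Fin N) ℝ) (hμ : IsDPP μ K) (hsymm : K.IsSymm)
    (hK : K.PosDef) (hKI : (1 - K).PosDef)
    (A B : Finset (Fin N)) (hAB : Disjoint A B) :
    ((pr μ (fun S => A ⊆ S ∧ B ⊆ S) = pr μ (fun S => A ⊆ S) * pr μ (fun S => B ⊆ S))
      ↔ subm K A B = 0) ∧
    ((subm K (A ∪ B) (A ∪ B)).det = (subm K A A).det * (subm K B B).det
      ↔ subm K A B = 0) := by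
  have hdet := det_subm_union_eq_mul_iff hK hAB
  refine ⟨?_, hdet⟩
  simp only [← Finset.union_subset_iff]
  rw [hμ.2.2, hμ.2.2, hμ.2.2]
  exact hdet
end

section
/- Let μ be a determinantal point process over 𝒴 = Fin N with real symmetric kernel K satisfying 0 ≺ K ≺ I, and let A and B be disjoint subsets of 𝒴. Then the processes Y ∩ A and Y ∩ B are independent — i.e. for all A₁ ⊆ A and B₁ ⊆ B, Pr(Y ∩ A = A₁ and Y ∩ B = B₁) = Pr(Y ∩ A = A₁)·Pr(Y ∩ B = B₁) — if and only if K_{A,B} = 0. -/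
open Matrix BigOperators

section Probability

variable {N : ℕ} {μ : Finset (Fin N) → ℝ}

/-- The events `E` and `F` are independent under `μ`. -/
def IndepEvents (μ : Finset (Fin N) → ℝ) (E F : Finset (Fin N) → Prop) : Prop :=
  pr μ (fun S => E S ∧ F S) = pr μ E * pr μ F

theorem IndepEvents.symm {E F : Finset (Fin N) → Prop} (h : IndepEvents μ E F) :
    IndepEvents μ F E := by
  unfold IndepEvents at *
  simp only [and_comm (a := F _), h, mul_comm]

theorem pr_and_not (E H : Finset (Fin N) → Prop) :
    pr μ (fun S => E S ∧ ¬ H S) = pr μ E - pr μ (fun S => E S ∧ H S) := by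
  unfold pr
  rw [← Finset.sum_sub_distrib]
  refine Finset.sum_congr rfl fun S _ => ?_
  by_cases hE : E S <;> by_cases hH : H S <;> simp [hE, hH]

theorem IndepEvents.and_not {E F H : Finset (Fin N) → Prop} (hE : IndepEvents μ E F)
    (hEH : IndepEvents μ (fun S => E S ∧ H S) F) :
    IndepEvents μ (fun S => E S ∧ ¬ H S) F := by
  unfold IndepEvents at *
  simp only [and_right_comm] at hEH ⊢
  rw [pr_and_not (fun S => E S ∧ F S) H, pr_and_not, hE, hEH, sub_mul]

/-- Independence from the events `{P ⊆ Y}` with `P ⊆ A` extends to the events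
`{P ⊆ Y, Y ∩ R = ∅}` with `P, R ⊆ A`. -/
theorem IndepEvents.subset_and_disjoint {A : Finset (Fin N)} {F : Finset (Fin N) → Prop}
    (h : ∀ P ⊆ A, IndepEvents μ (fun S => P ⊆ S) F) {R : Finset (Fin N)} :
    R ⊆ A → ∀ P ⊆ A, IndepEvents μ (fun S => P ⊆ S ∧ Disjoint R S) F := by
  induction R using Finset.induction_on with
  | empty => simpa using h
  | insert r R _ ih =>
    intro hR P hP
    have hR' := Finset.insert_subset_iff.mp hR
    have key := (ih hR'.2 P hP).and_not (H := fun S => r ∈ S) (by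
      simpa only [Finset.insert_subset_iff, and_comm, and_left_comm, and_assoc] using
        ih hR'.2 (insert r P) (Finset.insert_subset hR'.1 hP))
    simpa only [Finset.disjoint_insert_left, and_assoc, and_comm, and_left_comm] using key

theorem IndepEvents.inter_eq {A : Finset (Fin N)} {F : Finset (Fin N) → Prop}
    (h : ∀ P ⊆ A, IndepEvents μ (fun S => P ⊆ S) F) {A₁ : Finset (Fin N)} (hA₁ : A₁ ⊆ A) :
    IndepEvents μ (fun S => S ∩ A = A₁) F := by
  have hset : (fun S : Finset (Fin N) => S ∩ A = A₁)
      = fun S => A₁ ⊆ S ∧ Disjoint (A \ A₁) S := by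
    funext S
    refine propext ⟨?_, fun ⟨hsub, hdisj⟩ => ?_⟩
    · rintro rfl
      refine ⟨Finset.inter_subset_left, Finset.disjoint_left.mpr fun x hx hxS => ?_⟩
      simp_all
    · ext x
      have h1 := @hsub x
      have h2 := @hA₁ x
      have h3 : x ∈ A \ A₁ → x ∉ S := fun hx => Finset.disjoint_left.mp hdisj hx
      simp only [Finset.mem_sdiff, Finset.mem_inter] at h3 ⊢
      tauto
  rw [hset]
  exact IndepEvents.subset_and_disjoint h Finset.sdiff_subset A₁ hA₁

theorem pr_mem_and_eq_sum {A : Finset (Fin N)} {a : Fin N} (ha : a ∈ A)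
    (F : Finset (Fin N) → Prop) :
    pr μ (fun S => a ∈ S ∧ F S)
      = ∑ A₁ ∈ A.powerset with a ∈ A₁, pr μ (fun S => S ∩ A = A₁ ∧ F S) := by
  unfold pr
  rw [Finset.sum_comm]
  refine Finset.sum_congr rfl fun S _ => ?_
  by_cases hF : F S <;> simp [hF, ha]

theorem IndepEvents.mem {A : Finset (Fin N)} {F : Finset (Fin N) → Prop}
    (h : ∀ A₁ ⊆ A, IndepEvents μ (fun S => S ∩ A = A₁) F) {a : Fin N} (ha : a ∈ A) :
    IndepEvents μ (fun S => a ∈ S) F := by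
  have hpr : pr μ (fun S => a ∈ S)
      = ∑ A₁ ∈ A.powerset with a ∈ A₁, pr μ (fun S => S ∩ A = A₁) := by
    simpa using pr_mem_and_eq_sum (μ := μ) ha (fun _ => True)
  unfold IndepEvents
  rw [pr_mem_and_eq_sum ha, hpr, Finset.sum_mul]
  refine Finset.sum_congr rfl fun A₁ hA₁ => h A₁ ?_
  exact Finset.mem_powerset.mp (Finset.mem_filter.mp hA₁).1

end Probability

section Determinants

variable {N : ℕ} (K : Matrix (Fin N) (Fin N) ℝ)

theorem det_subm_union {P Q : Finset (Fin N)} (hPQ : Disjoint P Q) (h : subm K P Q = 0) :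
    (subm K (P ∪ Q) (P ∪ Q)).det = (subm K P P).det * (subm K Q Q).det := by
  rw [← Matrix.det_submatrix_equiv_self (Equiv.Finset.union P Q hPQ),
    ← Matrix.det_fromBlocks_zero₁₂ _ (subm K Q P), ← h]
  congr 1
  ext i j
  rcases i with i | i <;> rcases j with j | j <;> rfl

theorem det_subm_singleton (a : Fin N) : (subm K {a} {a}).det = K a a := by
  rw [Matrix.det_unique]
  rfl

theorem det_subm_pair {a b : Fin N} (hab : a ≠ b) :
    (subm K {a, b} {a, b}).det = K a a * K b b - K a b * K b a := by
  have hbij : Function.Bijective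
      (![⟨a, by simp⟩, ⟨b, by simp⟩] : Fin 2 → ({a, b} : Finset (Fin N))) := by
    constructor
    · intro i j
      fin_cases i <;> fin_cases j <;> simp [hab, hab.symm]
    · rintro ⟨x, hx⟩
      rcases Finset.mem_insert.mp hx with rfl | hx'
      · exact ⟨0, rfl⟩
      · exact ⟨1, Subtype.ext (Finset.mem_singleton.mp hx').symm⟩
  rw [← Matrix.det_submatrix_equiv_self (Equiv.ofBijective _ hbij), Matrix.det_fin_two]
  rfl

end Determinants

/-- For a DPP with kernel `0 ≺ K ≺ I` and disjoint `A`, `B`, the processes `Y ∩ A` and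
`Y ∩ B` are independent iff `K_{A,B} = 0`. -/
theorem dpp_restrict_independent_iff {N : ℕ} (μ : Finset (Fin N) → ℝ)
    (K : Matrix (Fin N) (Fin N) ℝ) (hμ : IsDPP μ K) (hsymm : K.IsSymm)
    (hK : K.PosDef) (hKI : (1 - K).PosDef)
    (A B : Finset (Fin N)) (hAB : Disjoint A B) :
    (∀ A₁ ⊆ A, ∀ B₁ ⊆ B,
      pr μ (fun S => S ∩ A = A₁ ∧ S ∩ B = B₁)
        = pr μ (fun S => S ∩ A = A₁) * pr μ (fun S => S ∩ B = B₁))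
    ↔ subm K A B = 0 := by
  obtain ⟨-, -, hdet⟩ := hμ
  constructor
  · intro h
    ext ⟨a, ha⟩ ⟨b, hb⟩
    have hab : a ≠ b := fun e => Finset.disjoint_left.mp hAB ha (e ▸ hb)
    have hind : IndepEvents μ (fun S => a ∈ S) (fun S => b ∈ S) :=
      IndepEvents.mem (fun A₁ hA₁ =>
        (IndepEvents.mem (fun B₁ hB₁ => IndepEvents.symm (h A₁ hA₁ B₁ hB₁)) hb).symm) ha
    have hpair := hdet {a, b}
    have h1 := hdet {a}
    have h2 := hdet {b}
    rw [det_subm_pair K hab] at hpair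
    rw [det_subm_singleton] at h1 h2
    simp only [Finset.insert_subset_iff, Finset.singleton_subset_iff] at hpair h1 h2
    rw [IndepEvents, hpair, h1, h2, hsymm.apply a b] at hind
    have hsq : K a b * K a b = 0 := by linarith
    exact mul_self_eq_zero.mp hsq
  · intro h A₁ hA₁ B₁ hB₁
    have hsub : ∀ P ⊆ A, ∀ Q ⊆ B, IndepEvents μ (fun S => P ⊆ S) (fun S => Q ⊆ S) := by
      intro P hP Q hQ
      have hzero : subm K P Q = 0 := by
        ext i j
        exact congrFun (congrFun h ⟨i, hP i.2⟩) ⟨j, hQ j.2⟩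
      have hPQ := hdet (P ∪ Q)
      rw [det_subm_union K (Finset.disjoint_of_subset_left hP
        (Finset.disjoint_of_subset_right hQ hAB)) hzero] at hPQ
      simpa only [IndepEvents, hdet, Finset.union_subset_iff] using hPQ
    exact IndepEvents.inter_eq (fun P hP =>
      (IndepEvents.inter_eq (fun Q hQ => (hsub P hP Q hQ).symm) hB₁).symm) hA₁
end

section
/- Let μ be a determinantal point process over 𝒴 = Fin N with real symmetric kernel K, and let C ⊆ 𝒴 satisfy det K_C > 0. Then for every A ⊆ 𝒴 disjoint from C, Pr(A ⊆ Y | C ⊆ Y) = det(K^C_A), where K^C = K_{C^c} − K_{C^c,C} K_C⁻¹ K_{C,C^c} is the Schur complement of K_C in K. -/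
open Matrix BigOperators

/-- The `A × B` block of the Schur complement `K^C = K_{Cᶜ} - K_{Cᶜ,C} K_C⁻¹ K_{C,Cᶜ}`,
i.e. `K_{A,B} - K_{A,C} K_C⁻¹ K_{C,B}` (for `A`, `B` disjoint from `C`). -/
noncomputable def schurBlock {N : ℕ} (K : Matrix (Fin N) (Fin N) ℝ)
    (C A B : Finset (Fin N)) : Matrix A B ℝ :=
  subm K A B - subm K A C * (subm K C C)⁻¹ * subm K C B

/-- The Schur determinant formula for the principal submatrix indexed by a disjoint union. -/
theorem det_subm_union_s9 {N : ℕ} (K : Matrix (Fin N) (Fin N) ℝ) {A C : Finset (Fin N)}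
    (hAC : Disjoint A C) (hC : IsUnit (subm K C C).det) :
    (subm K (A ∪ C) (A ∪ C)).det = (subm K C C).det * (schurBlock K C A A).det := by
  have := Matrix.invertibleOfIsUnitDet _ hC
  have hblocks : (subm K (A ∪ C) (A ∪ C)).submatrix
        (Equiv.Finset.union A C hAC) (Equiv.Finset.union A C hAC)
      = Matrix.fromBlocks (subm K A A) (subm K A C) (subm K C A) (subm K C C) := by
    ext i j
    rcases i with i | i <;> rcases j with j | j <;> simp [subm]
  rw [← Matrix.det_submatrix_equiv_self (Equiv.Finset.union A C hAC), hblocks,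
    Matrix.det_fromBlocks₂₂, Matrix.invOf_eq_nonsing_inv, schurBlock]

/-- For a DPP with kernel `K` and `C` with `det K_C > 0`, conditioned on `C ⊆ Y`,
the probability that `A ⊆ Y` equals `det (K^C_A)` where `K^C` is the Schur complement. -/
theorem dpp_cond_prob_eq_det_schur {N : ℕ} (μ : Finset (Fin N) → ℝ)
    (K : Matrix (Fin N) (Fin N) ℝ) (hμ : IsDPP μ K) (hsymm : K.IsSymm)
    (C : Finset (Fin N)) (hC : 0 < (subm K C C).det)
    (A : Finset (Fin N)) (hAC : Disjoint A C) :
    pr μ (fun S => A ∪ C ⊆ S) / pr μ (fun S => C ⊆ S)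
      = (schurBlock K C A A).det := by
  rw [hμ.2.2, hμ.2.2, det_subm_union_s9 K hAC hC.ne'.isUnit, mul_div_cancel_left₀ _ hC.ne']
end

section
/- Let K be a real symmetric positive definite N×N matrix, let i ≠ j be elements of Fin N, and let C = Fin N \ {i, j}. Then (K⁻¹)_{i j} = 0 if and only if (K^C)_{i j} = 0, where K^C is the Schur complement of K_C in K (a 2×2 matrix indexed by {i, j}). -/
open Matrix

/-- The `(i, j)` entry of the Schur complement `K^C = K_{Cᶜ} - K_{Cᶜ,C} K_C⁻¹ K_{C,Cᶜ}`
for `i, j ∉ C`. -/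
noncomputable def schurEntry {N : ℕ} (K : Matrix (Fin N) (Fin N) ℝ)
    (C : Finset (Fin N)) (i j : Fin N) : ℝ :=
  K i j - (fun c : C => K i c.1) ⬝ᵥ ((subm K C C)⁻¹ *ᵥ fun c : C => K c.1 j)

theorem mulVec_apply_eq_subtype_sum_add_pair {N : ℕ} (K : Matrix (Fin N) (Fin N) ℝ)
    {i j : Fin N} (hij : i ≠ j) (x : Fin N → ℝ) (a : Fin N) :
    (K *ᵥ x) a = (∑ c : ↥(Finset.univ \ {i, j} : Finset (Fin N)), K a c.1 * x c.1)
      + (K a i * x i + K a j * x j) := by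
  rw [Finset.sum_coe_sort (Finset.univ \ {i, j}) fun c => K a c * x c,
    ← Finset.sum_pair (f := fun c => K a c * x c) hij,
    Finset.sum_sdiff (Finset.subset_univ _)]
  rfl

/-- Eliminating the coordinates outside `{i, j}` from a linear system replaces the matrix by its
Schur complement. -/
theorem mulVec_apply_eq_schurEntry {N : ℕ} (K : Matrix (Fin N) (Fin N) ℝ)
    {i j : Fin N} (hij : i ≠ j)
    (hC : IsUnit (subm K (Finset.univ \ {i, j}) (Finset.univ \ {i, j})).det)
    (x : Fin N → ℝ) (hx : ∀ c ∈ Finset.univ \ {i, j}, (K *ᵥ x) c = 0) (a : Fin N) :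
    (K *ᵥ x) a = schurEntry K (Finset.univ \ {i, j}) a i * x i
      + schurEntry K (Finset.univ \ {i, j}) a j * x j := by
  have hsum := mulVec_apply_eq_subtype_sum_add_pair K hij x
  simp only [schurEntry]
  set C : Finset (Fin N) := Finset.univ \ {i, j}
  have hrow : subm K C C *ᵥ (fun c : C => x c.1)
      = -(x i • (fun c : C => K c.1 i) + x j • (fun c : C => K c.1 j)) := by
    funext c
    have h := hx c.1 c.2
    rw [hsum] at h
    simp only [Pi.neg_apply, Pi.add_apply, Pi.smul_apply, smul_eq_mul]
    change ∑ d : C, K c.1 d.1 * x d.1 = _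
    linarith
  have hsol : (fun c : C => x c.1)
      = -(x i • ((subm K C C)⁻¹ *ᵥ fun c : C => K c.1 i)
        + x j • ((subm K C C)⁻¹ *ᵥ fun c : C => K c.1 j)) := by
    rw [← mulVec_smul, ← mulVec_smul, ← mulVec_add, ← mulVec_neg, ← hrow, mulVec_mulVec,
      nonsing_inv_mul _ hC, one_mulVec]
  have hdot : ∑ c : C, K a c.1 * x c.1 = (fun c : C => K a c.1) ⬝ᵥ (fun c : C => x c.1) := rfl
  rw [hsum, hdot, hsol, dotProduct_neg, dotProduct_add, dotProduct_smul, dotProduct_smul,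
    smul_eq_mul, smul_eq_mul]
  ring

/-- For a symmetric positive definite `K` and `i ≠ j`, with `C = Fin N \ {i, j}`,
the `(i,j)` entry of `K⁻¹` vanishes iff the `(i,j)` entry of the Schur complement
`K^C` (a `2×2` matrix indexed by `{i, j}`) vanishes. -/
theorem inv_entry_eq_zero_iff_schur_entry_eq_zero {N : ℕ}
    (K : Matrix (Fin N) (Fin N) ℝ) (hsymm : K.IsSymm) (hK : K.PosDef)
    (i j : Fin N) (hij : i ≠ j) :
    K⁻¹ i j = 0 ↔ schurEntry K (Finset.univ \ {i, j}) i j = 0 := by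
  have hC : IsUnit (subm K (Finset.univ \ {i, j}) (Finset.univ \ {i, j})).det :=
    (hK.submatrix Subtype.val_injective).det_pos.ne'.isUnit
  have hmul (k a : Fin N) : (K *ᵥ fun b => K⁻¹ b k) a = (1 : Matrix (Fin N) (Fin N) ℝ) a k := by
    rw [← mul_nonsing_inv K hK.det_pos.ne'.isUnit]
    rfl
  have hj := mulVec_apply_eq_schurEntry K hij hC (fun b => K⁻¹ b j)
    (fun c hc => by rw [hmul, one_apply_ne]; rintro rfl; simp at hc) i
  have hi := mulVec_apply_eq_schurEntry K hij hC (fun b => K⁻¹ b i)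
    (fun c hc => by rw [hmul, one_apply_ne]; rintro rfl; simp at hc) i
  rw [hmul, one_apply_ne hij] at hj
  rw [hmul, one_apply_eq] at hi
  have hjj : K⁻¹ j j ≠ 0 := hK.inv.diag_pos.ne'
  constructor
  · intro h
    simpa [h, hjj] using hj.symm
  · intro h
    rw [h, zero_mul, add_zero] at hi hj
    exact (mul_eq_zero.mp hj.symm).resolve_left (left_ne_zero_of_mul_eq_one hi.symm)
end

section
/- Let μ be a determinantal point process over 𝒴 = Fin N with real symmetric kernel K satisfying 0 ≺ K ≺ I. Then the complement process 𝒴 \ Y is an L-ensemble with kernel L̄ = K⁻¹ − I: for every subset A of 𝒴, μ(𝒴 \ A) = det(L̄_A) · det(K), where det(L̄ + I) = det(K⁻¹) = 1/det(K). -/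
open Matrix BigOperators

/-- If `μ` satisfies the determinantal identities, the probability that `Y` contains `B` and avoids
`A` is the determinant of the matrix with the rows of `1 - K` over `A`, of `K` over `B`, and of `1`
elsewhere. -/
theorem IsDPP.pr_subset_and_disjoint {N : ℕ} {μ : Finset (Fin N) → ℝ}
    {K : Matrix (Fin N) (Fin N) ℝ} (hμ : IsDPP μ K) (A : Finset (Fin N)) :
    ∀ B, Disjoint A B → pr μ (fun S => B ⊆ S ∧ Disjoint A S) =
      (Matrix.of (A.piecewise (1 - K).row (B.piecewise K.row (1 : Matrix _ _ ℝ).row))).det := by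
  induction A using Finset.induction_on with
  | empty =>
    intro B _
    rw [Finset.piecewise_empty, det_piecewise_one_eq_submatrix_det]
    simp only [Finset.disjoint_empty_left, and_true]
    exact hμ.2.2 B
  | insert a A ha ih =>
    intro B hB
    rw [Finset.disjoint_insert_left] at hB
    have hsplit : pr μ (fun S => B ⊆ S ∧ Disjoint A S) =
        pr μ (fun S => insert a B ⊆ S ∧ Disjoint A S) +
          pr μ (fun S => B ⊆ S ∧ Disjoint (insert a A) S) := by
      simp only [pr, ← Finset.sum_add_distrib]
      refine Finset.sum_congr rfl fun S _ => ?_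
      by_cases h : a ∈ S <;>
        simp [Finset.insert_subset_iff, Finset.disjoint_insert_left, h]
    rw [ih B hB.2, ih (insert a B) (Finset.disjoint_insert_right.2 ⟨ha, hB.2⟩)] at hsplit
    set M := Matrix.of (A.piecewise (1 - K).row (B.piecewise K.row (1 : Matrix _ _ ℝ).row))
      with hM
    have hrow : M = M.updateRow a (K a + (1 - K) a) := by
      ext i j
      rcases eq_or_ne i a with rfl | h
      · simp [hM, Finset.piecewise, ha, hB.1]
      · simp [h]
    have hK : Matrix.of (A.piecewise (1 - K).row ((insert a B).piecewise K.row
        (1 : Matrix _ _ ℝ).row)) = M.updateRow a (K a) := by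
      ext i j
      rcases eq_or_ne i a with rfl | h
      · simp [Finset.piecewise, ha]
      · simp [hM, Finset.piecewise, h]
    have hK' : Matrix.of ((insert a A).piecewise (1 - K).row (B.piecewise K.row
        (1 : Matrix _ _ ℝ).row)) = M.updateRow a ((1 - K) a) := by
      ext i j
      rcases eq_or_ne i a with rfl | h
      · simp [Finset.piecewise]
      · simp [hM, Finset.piecewise, h]
    rw [hK, hrow, det_updateRow_add, ← hrow] at hsplit
    rw [hK']
    linarith

/-- The point masses of a determinantal point process. -/
theorem IsDPP.apply_compl {N : ℕ} {μ : Finset (Fin N) → ℝ}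
    {K : Matrix (Fin N) (Fin N) ℝ} (hμ : IsDPP μ K) (A : Finset (Fin N)) :
    μ Aᶜ = (Matrix.of (A.piecewise (1 - K).row K.row)).det := by
  have h := hμ.pr_subset_and_disjoint A Aᶜ disjoint_compl_right
  have hS (S : Finset (Fin N)) : (Aᶜ ⊆ S ∧ Disjoint A S) ↔ S = Aᶜ := by
    rw [disjoint_comm, ← le_compl_iff_disjoint_right, and_comm,
      ← le_antisymm_iff]
  have hrows : A.piecewise (1 - K).row (Aᶜ.piecewise K.row (1 : Matrix _ _ ℝ).row) =
      A.piecewise (1 - K).row K.row := by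
    ext i j
    by_cases hi : i ∈ A <;> simp [hi]
  simpa [pr, hS, hrows] using h

/-- Factoring `K` out on the right reduces the mixed determinant to a principal minor of
`K⁻¹ - 1`. -/
theorem det_piecewise_one_sub_row {N : ℕ} {K : Matrix (Fin N) (Fin N) ℝ} (hK : IsUnit K.det)
    (A : Finset (Fin N)) :
    (Matrix.of (A.piecewise (1 - K).row K.row)).det = (subm (K⁻¹ - 1) A A).det * K.det := by
  have hmul : Matrix.of (A.piecewise (1 - K).row K.row) =
      Matrix.of (A.piecewise (K⁻¹ - 1).row (1 : Matrix _ _ ℝ).row) * K := by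
    have h₁ : 1 - K = (K⁻¹ - 1) * K := by rw [sub_mul, nonsing_inv_mul _ hK, one_mul]
    have h₂ : K = 1 * K := (one_mul K).symm
    ext i j
    by_cases hi : i ∈ A
    · simpa [hi, mul_apply] using congrFun₂ h₁ i j
    · simpa [hi, mul_apply] using congrFun₂ h₂ i j
  rw [hmul, det_mul, det_piecewise_one_eq_submatrix_det]
  rfl

/-- For a DPP with kernel `0 ≺ K ≺ I`, the complement process `𝒴 \ Y` is an
`L`-ensemble with kernel `L̄ = K⁻¹ - I`: for every `A`,
`μ(Aᶜ) = det(L̄_A) * det K`, where `det(L̄ + I) = det (K⁻¹) = 1 / det K`. -/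
theorem dpp_complement_lEnsemble {N : ℕ} (μ : Finset (Fin N) → ℝ)
    (K : Matrix (Fin N) (Fin N) ℝ) (hμ : IsDPP μ K) (hsymm : K.IsSymm)
    (hK : K.PosDef) (hKI : (1 - K).PosDef) :
    (∀ A : Finset (Fin N), μ Aᶜ = (subm (K⁻¹ - 1) A A).det * K.det) ∧
    ((K⁻¹ - 1) + 1).det = K⁻¹.det ∧ K⁻¹.det = 1 / K.det := by
  refine ⟨fun A => ?_, by rw [sub_add_cancel], ?_⟩
  · rw [hμ.apply_compl, det_piecewise_one_sub_row hK.det_pos.ne'.isUnit]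
  · rw [det_nonsing_inv, Ring.inverse_eq_inv', one_div]
end

section
/- Let μ be a determinantal point process over 𝒴 = Fin N with real symmetric kernel K satisfying 0 ≺ K ≺ I, let L = K(I−K)⁻¹ be the kernel of the associated L-ensemble, and let i ≠ j be elements of 𝒴. Then the processes Y ∩ {i} and Y ∩ {j} are conditionally independent given the event ((𝒴 \ {i,j}) ∩ Y = ∅) — i.e. for all A₁ ⊆ {i} and B₁ ⊆ {j}, Pr(Y ∩ {i} = A₁ and Y ∩ {j} = B₁ and (𝒴\{i,j}) ∩ Y = ∅)·Pr((𝒴\{i,j}) ∩ Y = ∅) = Pr(Y ∩ {i} = A₁ and (𝒴\{i,j}) ∩ Y = ∅)·Pr(Y ∩ {j} = B₁ and (𝒴\{i,j}) ∩ Y = ∅) — if and only if L_{i j} = 0. -/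
open Matrix BigOperators

/-- The principal minor expansion of `det (1 + diagonal t * M)`. -/
theorem det_one_add_diagonal_mul_eq_sum_minors {N : ℕ} (t : Fin N → ℝ)
    (M : Matrix (Fin N) (Fin N) ℝ) :
    (1 + diagonal t * M).det = ∑ A : Finset (Fin N), (∏ k ∈ A, t k) * (subm M A A).det := by
  have h : (1 + diagonal t * M) =
      (fun k => t k • M k) + (fun k => (1 : Matrix (Fin N) (Fin N) ℝ) k) := by
    ext k l
    simp [add_comm]
  rw [h]
  unfold det
  rw [AlternatingMap.map_add_univ]
  refine Finset.sum_congr rfl fun A _ => ?_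
  have h2 : A.piecewise (fun k => t k • M k) (fun k => (1 : Matrix (Fin N) (Fin N) ℝ) k) =
      fun k => (if k ∈ A then t k else 1) •
        A.piecewise M.row (1 : Matrix (Fin N) (Fin N) ℝ).row k := by
    funext k
    by_cases hk : k ∈ A
    · rw [Finset.piecewise_eq_of_mem _ _ _ hk, Finset.piecewise_eq_of_mem _ _ _ hk, if_pos hk]
      rfl
    · rw [Finset.piecewise_eq_of_notMem _ _ _ hk, Finset.piecewise_eq_of_notMem _ _ _ hk,
        if_neg hk, one_smul]
      rfl
  rw [h2, AlternatingMap.map_smul_univ, Finset.prod_ite_mem, Finset.univ_inter, smul_eq_mul]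
  congr 1
  exact det_piecewise_one_eq_submatrix_det M A

/-- The probability generating function of a determinantal point process. -/
theorem IsDPP.sum_mul_prod {N : ℕ} {μ : Finset (Fin N) → ℝ} {K : Matrix (Fin N) (Fin N) ℝ}
    (hμ : IsDPP μ K) (w : Fin N → ℝ) :
    ∑ S : Finset (Fin N), μ S * ∏ k ∈ S, w k = (1 + diagonal (fun k => w k - 1) * K).det := by
  classical
  rw [det_one_add_diagonal_mul_eq_sum_minors]
  simp_rw [← hμ.2.2, pr, Finset.mul_sum]
  rw [Finset.sum_comm]
  refine Finset.sum_congr rfl fun S _ => ?_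
  have h : ∏ k ∈ S, w k = ∑ A ∈ S.powerset, ∏ k ∈ A, (w k - 1) := by
    rw [← Finset.prod_one_add]
    simp
  rw [h, Finset.mul_sum, ← Finset.sum_filter_add_sum_filter_not Finset.univ (fun A => A ⊆ S)]
  rw [Finset.sum_eq_zero (s := Finset.univ.filter fun A => ¬ A ⊆ S), add_zero]
  · refine Finset.sum_congr (by ext; simp) fun A hA => ?_
    rw [if_pos (by simpa using hA), mul_comm]
  · intro A hA
    rw [if_neg (by simpa using hA), mul_zero]

/-- The generating function of a determinantal point process in terms of its `L`-ensemble kernel. -/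
theorem IsDPP.sum_mul_prod_eq_det_mul_det {N : ℕ} {μ : Finset (Fin N) → ℝ}
    {K : Matrix (Fin N) (Fin N) ℝ} (hμ : IsDPP μ K) (hKI : IsUnit (1 - K).det)
    (w : Fin N → ℝ) :
    ∑ S : Finset (Fin N), μ S * ∏ k ∈ S, w k =
      (1 - K).det * (1 + diagonal w * (K * (1 - K)⁻¹)).det := by
  rw [hμ.sum_mul_prod, mul_comm, ← det_mul, add_mul, one_mul, mul_assoc, mul_assoc,
    nonsing_inv_mul _ hKI, mul_one]
  congr 1
  have : diagonal (fun k => w k - 1) = diagonal w - 1 := by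
    rw [← diagonal_one, diagonal_sub]
  rw [this, sub_mul, one_mul]
  abel

theorem det_one_add_diagonal_pair_mul {N : ℕ} (L : Matrix (Fin N) (Fin N) ℝ) {i j : Fin N}
    (hij : i ≠ j) (x y : ℝ) :
    (1 + diagonal (fun k => if k = i then x else if k = j then y else 0) * L).det =
      (1 + x * L i i) * (1 + y * L j j) - x * y * (L i j * L j i) := by
  let U : Matrix (Fin N) (Fin 2) ℝ := fun k a => if k = ![i, j] a then ![x, y] a else 0
  let V : Matrix (Fin 2) (Fin N) ℝ := fun a k => L (![i, j] a) k
  have hUV : diagonal (fun k => if k = i then x else if k = j then y else 0) * L = U * V := by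
    ext k l
    rw [diagonal_mul, mul_apply, Fin.sum_univ_two]
    by_cases hi : k = i
    · subst hi
      simp [U, V, hij]
    · by_cases hj : k = j
      · subst hj
        simp [U, V, hi]
      · simp [U, V, hi, hj]
  have hVU : ∀ a b, (V * U) a b = L (![i, j] a) (![i, j] b) * ![x, y] b := fun a b => by
    rw [mul_apply]
    simp [U, V]
  rw [hUV, det_one_add_mul_comm, det_fin_two]
  simp [hVU]
  ring

theorem sum_eq_of_support_subset_pair {N : ℕ} {i j : Fin N} (hij : i ≠ j)
    (f : Finset (Fin N) → ℝ) (hf : ∀ S, ¬ S ⊆ {i, j} → f S = 0) :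
    ∑ S : Finset (Fin N), f S = f ∅ + f {i} + f {j} + f {i, j} := by
  rw [← Finset.sum_subset (Finset.subset_univ ({i, j} : Finset (Fin N)).powerset)
    fun S _ hS => hf S (by simpa using hS)]
  have hj : ∀ g : Finset (Fin N) → ℝ, ∑ S ∈ ({j} : Finset (Fin N)).powerset, g S = g ∅ + g {j} := by
    intro g
    rw [← insert_empty_eq j, Finset.sum_powerset_insert (by simp)]
    simp
  rw [Finset.sum_powerset_insert (by simpa using hij), hj, hj, insert_empty_eq]
  ring

open scoped Classical in
theorem pr_eq_of_forall_subset_pair {N : ℕ} (μ : Finset (Fin N) → ℝ) {i j : Fin N} (hij : i ≠ j)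
    (E : Finset (Fin N) → Prop) (hE : ∀ S, E S → S ⊆ {i, j}) :
    pr μ E = (if E ∅ then μ ∅ else 0) + (if E {i} then μ {i} else 0)
      + (if E {j} then μ {j} else 0) + (if E {i, j} then μ {i, j} else 0) :=
  sum_eq_of_support_subset_pair hij _ fun S hS => if_neg fun h => hS (hE S h)

/-- For a DPP with kernel `0 ≺ K ≺ I`, with `L = K (I - K)⁻¹` the kernel of the
associated `L`-ensemble, and `i ≠ j`, the processes `Y ∩ {i}` and `Y ∩ {j}` are
conditionally independent given `(Fin N \ {i,j}) ∩ Y = ∅` iff `L_{i j} = 0`. -/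
theorem dpp_singleton_cond_independent_iff_L {N : ℕ} (μ : Finset (Fin N) → ℝ)
    (K : Matrix (Fin N) (Fin N) ℝ) (hμ : IsDPP μ K) (hsymm : K.IsSymm)
    (hK : K.PosDef) (hKI : (1 - K).PosDef) (i j : Fin N) (hij : i ≠ j) :
    (∀ A₁ ⊆ ({i} : Finset (Fin N)), ∀ B₁ ⊆ ({j} : Finset (Fin N)),
      pr μ (fun S => S ∩ {i} = A₁ ∧ S ∩ {j} = B₁ ∧ (Finset.univ \ {i, j}) ∩ S = ∅)
          * pr μ (fun S => (Finset.univ \ {i, j}) ∩ S = ∅)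
        = pr μ (fun S => S ∩ {i} = A₁ ∧ (Finset.univ \ {i, j}) ∩ S = ∅)
          * pr μ (fun S => S ∩ {j} = B₁ ∧ (Finset.univ \ {i, j}) ∩ S = ∅))
    ↔ (K * (1 - K)⁻¹) i j = 0 := by
  classical
  have hdet : 0 < (1 - K).det := hKI.det_pos
  have hLsymm : (K * (1 - K)⁻¹) j i = (K * (1 - K)⁻¹) i j := by
    have hunit : IsUnit (1 - K).det := hdet.ne'.isUnit
    have hcomm : K * (1 - K)⁻¹ = (1 - K)⁻¹ - 1 := by
      have h := mul_nonsing_inv _ hunit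
      rw [sub_mul, one_mul] at h
      exact eq_sub_of_add_eq (by rw [add_comm, ← sub_eq_iff_eq_add.1 h])
    have hS : (K * (1 - K)⁻¹)ᵀ = K * (1 - K)⁻¹ := by
      rw [hcomm, transpose_sub, transpose_nonsing_inv, transpose_sub, transpose_one, hsymm.eq]
    exact congrFun (congrFun hS i) j
  have hgen : ∀ x y : ℝ, μ ∅ + μ {i} * x + μ {j} * y + μ {i, j} * (x * y) =
      (1 - K).det * ((1 + x * (K * (1 - K)⁻¹) i i) * (1 + y * (K * (1 - K)⁻¹) j j)
        - x * y * ((K * (1 - K)⁻¹) i j * (K * (1 - K)⁻¹) j i)) := by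
    intro x y
    rw [← det_one_add_diagonal_pair_mul _ hij,
      ← hμ.sum_mul_prod_eq_det_mul_det hdet.ne'.isUnit, sum_eq_of_support_subset_pair hij]
    · simp [hij, hij.symm]
    · intro S hS
      obtain ⟨k, hkS, hk⟩ := Finset.not_subset.1 hS
      simp only [Finset.mem_insert, Finset.mem_singleton, not_or] at hk
      rw [Finset.prod_eq_zero hkS (by simp [hk]), mul_zero]
  rw [hLsymm] at hgen
  generalize (K * (1 - K)⁻¹) i j = a at *
  generalize (K * (1 - K)⁻¹) i i = b at *
  generalize (K * (1 - K)⁻¹) j j = d at *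
  have h00 := hgen 0 0
  have h10 := hgen 1 0
  have h01 := hgen 0 1
  have h11 := hgen 1 1
  have hsub : ∀ S : Finset (Fin N), (Finset.univ \ {i, j}) ∩ S = ∅ ↔ S ⊆ {i, j} := by
    intro S
    rw [← Finset.disjoint_iff_inter_eq_empty, ← Finset.compl_eq_univ_sdiff,
      disjoint_comm, disjoint_compl_right_iff]
  have hcov : μ {i, j} * μ ∅ - μ {i} * μ {j} = -((1 - K).det * a) ^ 2 := by
    have e0 : μ ∅ = (1 - K).det := by linarith
    have e1 : μ {i} = (1 - K).det * b := by linarith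
    have e2 : μ {j} = (1 - K).det * d := by linarith
    have e3 : μ {i, j} = (1 - K).det * (b * d - a * a) := by linarith
    rw [e0, e1, e2, e3]
    ring
  simp only [hsub]
  have hkey : μ {i, j} * μ ∅ = μ {i} * μ {j} ↔ a = 0 := by
    rw [← sub_eq_zero, hcov]
    simp [hdet.ne']
  rw [← hkey]
  have hji : ({i, j} : Finset (Fin N)) ∩ {j} = {j} := by simp
  have hii : ({i, j} : Finset (Fin N)) ∩ {i} = {i} := by simp
  have hi0 : ({i} : Finset (Fin N)) ∩ {j} = ∅ := by simp [hij]
  have hj0 : ({j} : Finset (Fin N)) ∩ {i} = ∅ := by simp [hij.symm]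
  constructor
  · intro h
    have h1 := h ∅ (by simp) ∅ (by simp)
    rw [pr_eq_of_forall_subset_pair μ hij _ (by tauto),
      pr_eq_of_forall_subset_pair μ hij _ (by tauto),
      pr_eq_of_forall_subset_pair μ hij _ (by tauto),
      pr_eq_of_forall_subset_pair μ hij _ (by tauto)] at h1
    simp [hji, hii, hi0, hj0] at h1
    linarith
  · intro h A hA B hB
    rw [pr_eq_of_forall_subset_pair μ hij _ (by tauto),
      pr_eq_of_forall_subset_pair μ hij _ (by tauto),
      pr_eq_of_forall_subset_pair μ hij _ (by tauto),
      pr_eq_of_forall_subset_pair μ hij _ (by tauto)]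
    rcases Finset.subset_singleton_iff.1 hA with rfl | rfl <;>
    rcases Finset.subset_singleton_iff.1 hB with rfl | rfl <;>
    simp [hji, hii, hi0, hj0, (Finset.singleton_ne_empty _).symm] <;> linarith
end
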